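/- arXiv:2503.01985 — 2 statements merged into one kernel-verified Lean document; each statement's English description precedes it below -/
import Mathlib

section
/- Let E=(C,V,k,B) be an election and let W be an outcome returned by Phragmén's rule for thumbs-up/down voting. Then for every nonempty group of voters S ⊆ V and every positive integer ℓ such that S is ℓ-cohesive, the average satisfaction of S satisfies avgsat_S(W) ≥ (ℓ − 1)/2. -/
open Finset

variable {C V : Type*}

/-- The set of (virtual) positive copies of a set of candidates. -/
def posOf [DecidableEq C] (X : Finset C) : Finset (C ⊕ C) := X.image Sum.inl

/-- The set of virtual negative counterparts `¬c` of a set of candidates. -/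
def negOf [DecidableEq C] (X : Finset C) : Finset (C ⊕ C) := X.image Sum.inr

/-- The positive part `W ∩ C` of an outcome `W ⊆ C ∪ ¬C`. -/
def posPart [Fintype C] [DecidableEq C] (W : Finset (C ⊕ C)) : Finset C :=
  univ.filter (fun c => Sum.inl c ∈ W)

/-- Feasibility: at most `k` positive candidates, and never both `c` and `¬c`. -/
def Feasible [Fintype C] [DecidableEq C] (k : ℕ) (W : Finset (C ⊕ C)) : Prop :=
  (posPart W).card ≤ k ∧ ∀ c : C, ¬ (Sum.inl c ∈ W ∧ Sum.inr c ∈ W)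

/-- Common intersection `⋂_{i ∈ S} F i` (e.g. `A_S` or `D_S`). -/
def comInt [Fintype C] [DecidableEq C] (F : V → Finset C) (S : Finset V) : Finset C :=
  univ.filter (fun c => ∀ i ∈ S, c ∈ F i)

/-- Utility of voter `i` in the symmetric model: `|A_i ∩ W| + |¬D_i ∩ W|`. -/
def util [DecidableEq C] (A D : V → Finset C) (i : V) (W : Finset (C ⊕ C)) : ℕ :=
  ((posOf (A i) ∪ negOf (D i)) ∩ W).card

/-- `ℓ`-cohesiveness of a group `S` in the symmetric model. -/
def Cohesive [Fintype C] [DecidableEq C] [Fintype V] (A D : V → Finset C)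
    (k ℓ : ℕ) (S : Finset V) : Prop :=
  ∀ T : Finset (C ⊕ C), Feasible k T →
    (∃ X ⊆ posOf (comInt A S) ∪ negOf (comInt D S), ℓ ≤ X.card ∧ Feasible k (T ∪ X)) ∨
    (ℓ : ℚ) / ((T.card : ℚ) + (ℓ : ℚ)) < (S.card : ℚ) / (Fintype.card V : ℚ)

/-- The closed formula `claim(S)`, given `n = |V|`, `m = |C|`, `k`, `s = |S|`,
`aS = |A_S|`, `dS = |D_S|`. -/
def claimQ (n m k s aS dS : ℕ) : ℚ :=
  if (n : ℚ) / ((n : ℚ) - (s : ℚ)) * k ≤ (dS : ℚ) then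
    (dS : ℚ) - (k : ℚ)
  else if ((n : ℚ) - (s : ℚ)) / n * k ≤ (dS : ℚ) ∧
      (dS : ℚ) ≤ (n : ℚ) / ((n : ℚ) - (s : ℚ)) * k ∧
      (k : ℚ) ≤ (2 * (n : ℚ) - (s : ℚ)) / n * aS + ((n : ℚ) - (s : ℚ)) / n * dS then
    (s : ℚ) / (2 * (n : ℚ) - (s : ℚ)) * ((dS : ℚ) + (k : ℚ))
  else if (k : ℚ) ≤ (aS : ℚ) + (dS : ℚ) ∧ (dS : ℚ) ≤ ((n : ℚ) - (s : ℚ)) / n * k ∧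
      (aS : ℚ) ≤ (m : ℚ) - ((n : ℚ) - (s : ℚ)) / n * k then
    (s : ℚ) / n * k
  else if (k : ℚ) ≤ (aS : ℚ) + (dS : ℚ) ∧ (dS : ℚ) ≤ ((n : ℚ) - (s : ℚ)) / n * k ∧
      (m : ℚ) - ((n : ℚ) - (s : ℚ)) / n * k ≤ (aS : ℚ) ∧
      (aS : ℚ) + (k : ℚ) - (m : ℚ) ≤ (s : ℚ) / n * ((aS : ℚ) + (dS : ℚ)) then
    (aS : ℚ) + (k : ℚ) - (m : ℚ)
  else
    (s : ℚ) / n * ((aS : ℚ) + (dS : ℚ))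

/-- Supporters of an item: approvers of `c` for a positive candidate `c`,
disapprovers of `c` for a negative counterpart `¬c`. -/
def supporters [Fintype V] [DecidableEq C] (A D : V → Finset C) : C ⊕ C → Finset V
  | Sum.inl c => univ.filter (fun i => c ∈ A i)
  | Sum.inr c => univ.filter (fun i => c ∈ D i)

/-- Availability of an item `x` just before the `j`-th purchase of a run with
purchase sequence `item`: neither `x` nor its counterpart has been bought yet,
and if `x` is a positive candidate then fewer than `k` positive candidates
have been bought so far. -/
def availAt [DecidableEq C] (k : ℕ) {num : ℕ} (item : Fin num → C ⊕ C)
    (j : ℕ) (x : C ⊕ C) : Prop :=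
  (∀ j' : Fin num, (j' : ℕ) < j → item j' ≠ x ∧ item j' ≠ x.swap) ∧
  (x.isLeft = true →
    (univ.filter (fun j' : Fin num => (j' : ℕ) < j ∧ (item j').isLeft = true)).card < k)

/-- An execution of Phragmén's rule for thumbs-up/down voting.  All voters earn
money continuously at unit rate; `item j` is the `j`-th bought item (a candidate
or a negative counterpart, each of cost 1), bought at time `time j`; `bud j i` is
the unspent budget of voter `i` just before the `j`-th purchase (the budgets of
all supporters of a bought item are reset to 0, i.e. spent in full).  Purchases
happen as soon as the supporters of an available item jointly hold 1 unit of
money, and the run stops only when no available item can ever be bought. -/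
structure PhragmenExec [Fintype C] [DecidableEq C] [Fintype V] [DecidableEq V]
    (A D : V → Finset C) (k : ℕ) where
  num : ℕ
  item : Fin num → C ⊕ C
  time : Fin num → ℝ
  bud : Fin num → V → ℝ
  time_nonneg : ∀ j, 0 ≤ time j
  time_mono : Monotone time
  bud_def : ∀ (j : Fin num) (i : V),
    bud j i = time j - ∑ j' ∈ univ.filter
      (fun j' : Fin num => j' < j ∧ i ∈ supporters A D (item j')), bud j' i
  item_avail : ∀ j : Fin num, availAt k item (j : ℕ) (item j)
  pay : ∀ j : Fin num, ∑ i ∈ supporters A D (item j), bud j i = 1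
  eager : ∀ (j : Fin num) (x : C ⊕ C), availAt k item (j : ℕ) x →
    ∑ i ∈ supporters A D x, bud j i ≤ 1
  exhaust : ∀ x : C ⊕ C, availAt k item num x → supporters A D x = ∅

theorem mem_supporters_iff [Fintype V] [DecidableEq C] {A D : V → Finset C} {i : V}
    {x : C ⊕ C} : i ∈ supporters A D x ↔ x ∈ posOf (A i) ∪ negOf (D i) := by
  cases x <;> simp [supporters, posOf, negOf]

theorem subset_supporters_of_mem_common [Fintype C] [Fintype V] [DecidableEq C]
    {A D : V → Finset C} {S : Finset V} {x : C ⊕ C}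
    (hx : x ∈ posOf (comInt A S) ∪ negOf (comInt D S)) : S ⊆ supporters A D x := by
  intro i hi
  cases x <;> simp [posOf, negOf, comInt] at hx <;> simp [supporters, hx i hi]

theorem not_mem_supporters_swap [Fintype V] [DecidableEq C] {A D : V → Finset C}
    (hdisj : ∀ i, Disjoint (A i) (D i)) {i : V} {x : C ⊕ C}
    (hx : i ∈ supporters A D x) : i ∉ supporters A D x.swap := by
  have h := hdisj i
  rw [Finset.disjoint_left] at h
  cases x with
  | inl c => simp only [supporters, Sum.swap_inl, mem_filter, mem_univ, true_and] at *; exact h hx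
  | inr c =>
    simp only [supporters, Sum.swap_inr, mem_filter, mem_univ, true_and] at *
    exact fun h' => h h' hx

theorem card_posPart [Fintype C] [DecidableEq C] (W : Finset (C ⊕ C)) :
    (posPart W).card = (W.filter (fun x => x.isLeft = true)).card := by
  have : W.filter (fun x => x.isLeft = true) = (posPart W).image Sum.inl := by
    ext x; cases x <;> simp [_root_.posPart]
  rw [this, card_image_of_injective _ Sum.inl_injective]

theorem Feasible.mono [Fintype C] [DecidableEq C] {k : ℕ} {T W : Finset (C ⊕ C)}
    (hW : Feasible k W) (h : T ⊆ W) : Feasible k T := by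
  refine ⟨le_trans (card_le_card fun c hc => ?_) hW.1, fun c hc => hW.2 c ⟨h hc.1, h hc.2⟩⟩
  simp only [_root_.posPart, mem_filter, mem_univ, true_and] at *
  exact h hc

theorem Feasible.swap_notMem [Fintype C] [DecidableEq C] {k : ℕ} {W : Finset (C ⊕ C)}
    (hW : Feasible k W) {x : C ⊕ C} (hx : x ∈ W) : x.swap ∉ W := by
  intro h
  cases x with
  | inl c => exact hW.2 c ⟨hx, h⟩
  | inr c => exact hW.2 c ⟨h, hx⟩

/-- If all but fewer than `ℓ` members of `W`, none of the removed ones blocking a member of `X`,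
can be extended by `ℓ` items `X`, then some member of `X` can be added to `W`. -/
theorem exists_addable [Fintype C] [DecidableEq C] {k ℓ : ℕ} {W R X : Finset (C ⊕ C)}
    (hXW : X ∩ W ⊆ R) (hXR : ∀ x ∈ X, x.swap ∉ R) (hR : R.card < ℓ)
    (hX : ℓ ≤ X.card) (hf : Feasible k (W \ R ∪ X)) :
    ∃ x ∈ X, x ∉ W ∧ x.swap ∉ W ∧ (x.isLeft = true → (posPart W).card < k) := by
  have hswap : ∀ x ∈ X, x.swap ∉ W := fun x hx hxW =>
    hf.swap_notMem (mem_union_right _ hx) (mem_union_left _ (mem_sdiff.2 ⟨hxW, hXR x hx⟩))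
  by_contra! hno
  have hcard : (R \ X).card < (X \ W).card := by
    have h1 := card_sdiff_add_card_inter X W
    have h2 := card_sdiff_add_card_inter R X
    have h3 : (X ∩ W).card ≤ (R ∩ X).card :=
      card_le_card fun x hx => mem_inter.2 ⟨hXW hx, (mem_inter.1 hx).1⟩
    omega
  have hleft : ∀ x ∈ X \ W, x.isLeft = true ∧ k ≤ (posPart W).card := fun x hx =>
    hno x (mem_sdiff.1 hx).1 (mem_sdiff.1 hx).2 (hswap x (mem_sdiff.1 hx).1)
  obtain ⟨x, hx⟩ := card_pos.1 (Nat.zero_lt_of_lt hcard)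
  have hk := (hleft x hx).2
  have hk' := hf.1
  rw [card_posPart] at hk hk'
  set L := W.filter (fun x => x.isLeft = true)
  set L' := (W \ R ∪ X).filter (fun x => x.isLeft = true)
  have h1 := card_sdiff_add_card_inter L L'
  have h2 := card_sdiff_add_card_inter L' L
  rw [inter_comm] at h2
  have h3 : (L \ L').card ≤ (R \ X).card := card_le_card fun y hy => by
    simp only [L, L', mem_sdiff, mem_filter, mem_union] at hy ⊢
    tauto
  have h4 : (X \ W).card ≤ (L' \ L).card := card_le_card fun y hy => by
    have := (hleft y hy).1
    simp only [L, L', mem_sdiff, mem_filter, mem_union] at hy ⊢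
    tauto
  omega

/-- A purchase paid by `P ⊆ S` at time `t`, when voter `i` has already spent `r i` and the members
of `S` jointly hold at most one unit, changes the potential `|S| ∑ r i ^ 2 - (∑ r i) ^ 2` by an
amount controlled by the number of payers and the amount paid. -/
theorem potential_step {S P : Finset V} [DecidableEq V] (hP : P ⊆ S) (r : V → ℝ) (t : ℝ)
    (hr : ∀ i ∈ S, r i ≤ t) (hf : ∑ i ∈ S, (t - r i) ≤ 1) :
    (S.card : ℝ) * (2 * ∑ i ∈ P, (t - r i) +
      ((S.card : ℝ) * ∑ i ∈ S, (if i ∈ P then t else r i) ^ 2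
          - (∑ i ∈ S, if i ∈ P then t else r i) ^ 2)
        - ((S.card : ℝ) * ∑ i ∈ S, r i ^ 2 - (∑ i ∈ S, r i) ^ 2)) ≤ 4 * P.card := by
  set s : ℝ := (S.card : ℝ)
  set q := ∑ i ∈ P, (t - r i) with hq
  have hs : 0 ≤ s := Nat.cast_nonneg _
  have hq0 : 0 ≤ q := sum_nonneg fun i hi => sub_nonneg.2 (hr i (hP hi))
  have hind : ∀ g : V → ℝ, ∑ i ∈ S, (if i ∈ P then g i else 0) = ∑ i ∈ P, g i := fun g => by
    rw [← sum_filter, filter_mem_eq_inter, inter_eq_right.2 hP]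
  have h1 : ∑ i ∈ S, (if i ∈ P then t else r i) = ∑ i ∈ S, r i + q := by
    rw [hq, ← hind, ← sum_add_distrib]
    exact sum_congr rfl fun i _ => by split_ifs <;> ring
  have h2 : ∑ i ∈ S, (if i ∈ P then t else r i) ^ 2
      = ∑ i ∈ S, r i ^ 2 + (2 * t * q - ∑ i ∈ P, (t - r i) ^ 2) := by
    rw [hq, mul_sum, ← sum_sub_distrib, ← hind, ← sum_add_distrib]
    exact sum_congr rfl fun i _ => by split_ifs <;> ring
  have h3 : ∑ i ∈ S, (t - r i) = s * t - ∑ i ∈ S, r i := by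
    simp [sum_sub_distrib, s]
  have h4 : s * (4 * q - s * ∑ i ∈ P, (t - r i) ^ 2) ≤ 4 * P.card := by
    have : ∑ i ∈ P, (4 * s * (t - r i) - s ^ 2 * (t - r i) ^ 2) ≤ ∑ _i ∈ P, (4 : ℝ) :=
      sum_le_sum fun i _ => by nlinarith [sq_nonneg (s * (t - r i) - 2)]
    rw [sum_sub_distrib, ← mul_sum, ← mul_sum, sum_const, nsmul_eq_mul] at this
    linarith
  rw [h1, h2]
  rw [h3] at hf
  have h5 := mul_le_mul_of_nonneg_left (mul_le_mul_of_nonneg_right hf hq0) hs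
  nlinarith [mul_nonneg hs (sq_nonneg q)]

namespace PhragmenExec

variable [Fintype C] [DecidableEq C] [Fintype V] [DecidableEq V] {A D : V → Finset C} {k : ℕ}

/-- The indices of the first `j` purchases. -/
def before (E : PhragmenExec A D k) (j : ℕ) : Finset (Fin E.num) :=
  univ.filter (fun j' => (j' : ℕ) < j)

/-- The items bought in the first `j` purchases. -/
def bought (E : PhragmenExec A D k) (j : ℕ) : Finset (C ⊕ C) := (E.before j).image E.item

/-- The money spent by voter `i` in the first `j` purchases. -/
def spent (E : PhragmenExec A D k) (j : ℕ) (i : V) : ℝ :=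
  ∑ j' ∈ E.before j, if i ∈ supporters A D (E.item j') then E.bud j' i else 0

variable (E : PhragmenExec A D k)

theorem before_zero : E.before 0 = ∅ := by simp [before]

theorem notMem_before (j : Fin E.num) : j ∉ E.before j := by simp [before]

theorem before_succ (j : Fin E.num) : E.before (j + 1) = insert j (E.before j) := by
  ext j'
  simp only [before, mem_filter, mem_univ, true_and, mem_insert, Fin.ext_iff]
  omega

theorem card_before {j : ℕ} (hj : j ≤ E.num) : (E.before j).card = j := by
  induction j with
  | zero => simp [before_zero]
  | succ j ih =>
    have := E.before_succ ⟨j, hj⟩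
    simp only at this
    rw [this, card_insert_of_notMem (E.notMem_before ⟨j, hj⟩), ih (by omega)]

theorem item_injective : Function.Injective E.item := by
  intro a b hab
  rcases lt_trichotomy a b with h | h | h
  · exact absurd hab ((E.item_avail b).1 a h).1
  · exact h
  · exact absurd hab.symm ((E.item_avail a).1 b h).1

theorem card_bought {j : ℕ} (hj : j ≤ E.num) : (E.bought j).card = j := by
  rw [bought, card_image_of_injective _ E.item_injective, E.card_before hj]

theorem card_posPart_bought (j : ℕ) : (posPart (E.bought j)).card =
    (univ.filter (fun j' : Fin E.num => (j' : ℕ) < j ∧ (E.item j').isLeft = true)).card := by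
  rw [card_posPart, bought, filter_image, card_image_of_injective _ E.item_injective, before,
    filter_filter]

theorem availAt_of_notMem {j : ℕ} {x : C ⊕ C} (hx : x ∉ E.bought j) (hx' : x.swap ∉ E.bought j)
    (hk : x.isLeft = true → (posPart (E.bought j)).card < k) : availAt k E.item j x := by
  refine ⟨fun j' hj' => ⟨?_, ?_⟩, fun h => E.card_posPart_bought j ▸ hk h⟩
  · rintro rfl
    exact hx (mem_image_of_mem _ (by simpa [before] using hj'))
  · intro h
    exact hx' (h ▸ mem_image_of_mem _ (by simpa [before] using hj'))

theorem card_posPart_bought_le {j : ℕ} (hj : j ≤ E.num) : (posPart (E.bought j)).card ≤ k := by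
  rw [E.card_posPart_bought]
  induction j with
  | zero => simp
  | succ j ih =>
    have hav := (E.item_avail ⟨j, hj⟩).2
    have h := E.before_succ ⟨j, hj⟩
    have hfil : ∀ m, univ.filter (fun j' : Fin E.num => (j' : ℕ) < m ∧ (E.item j').isLeft = true)
        = (E.before m).filter (fun j' => (E.item j').isLeft = true) := fun m => by
      rw [before, filter_filter]
    simp only [hfil] at h hav ih ⊢
    rw [h, filter_insert]
    split_ifs with hl
    · exact (card_insert_le _ _).trans (hav hl)
    · exact ih (by omega)

theorem feasible_bought {j : ℕ} (hj : j ≤ E.num) : Feasible k (E.bought j) := by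
  refine ⟨E.card_posPart_bought_le hj, ?_⟩
  rintro c ⟨h1, h2⟩
  obtain ⟨a, -, ha⟩ := mem_image.1 h1
  obtain ⟨b, -, hb⟩ := mem_image.1 h2
  rcases lt_trichotomy a b with h | h | h
  · exact ((E.item_avail b).1 a h).2 (by simp [ha, hb])
  · subst h; simp [ha] at hb
  · exact ((E.item_avail a).1 b h).2 (by simp [ha, hb])

theorem spent_zero (i : V) : E.spent 0 i = 0 := by simp [spent, before_zero]

theorem bud_eq (j : Fin E.num) (i : V) : E.bud j i = E.time j - E.spent j i := by
  rw [E.bud_def, spent, ← sum_filter, before, filter_filter]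
  rfl

theorem spent_succ (j : Fin E.num) (i : V) : E.spent (j + 1) i =
    if i ∈ supporters A D (E.item j) then E.time j else E.spent j i := by
  rw [spent, E.before_succ, sum_insert (E.notMem_before j), ← spent, E.bud_eq]
  split_ifs <;> ring

theorem spent_le_time {j : ℕ} (hj : j ≤ E.num) (j' : Fin E.num) (hjj' : j ≤ j' + 1) (i : V) :
    E.spent j i ≤ E.time j' := by
  induction j with
  | zero => rw [spent_zero]; exact E.time_nonneg j'
  | succ j ih =>
    have := E.spent_succ ⟨j, hj⟩ i
    simp only at this
    rw [this]
    split_ifs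
    · exact E.time_mono (Fin.le_def.2 (by simpa using hjj'))
    · exact ih (by omega) (by omega)

theorem bud_nonneg (j : Fin E.num) (i : V) : 0 ≤ E.bud j i := by
  rw [bud_eq, sub_nonneg]
  exact E.spent_le_time j.2.le j (by omega) i

theorem sum_bud_le_one {S : Finset V} (j : Fin E.num) {x : C ⊕ C}
    (hx : S ⊆ supporters A D x) (hav : availAt k E.item j x) :
    ∑ i ∈ S, (E.time j - E.spent j i) ≤ 1 := by
  simp only [← bud_eq]
  exact (sum_le_sum_of_subset_of_nonneg hx fun i _ _ => E.bud_nonneg j i).trans (E.eager j x hav)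

/-- While the members of `S` never jointly hold more than one unit before a purchase, the number
of payments they make is at least `|S| / 2` times the money they spend. -/
theorem spent_le_card_payments {S : Finset V} {j : ℕ} (hj : j ≤ E.num)
    (hf : ∀ j' : Fin E.num, (j' : ℕ) < j → ∑ i ∈ S, (E.time j' - E.spent j' i) ≤ 1) :
    (S.card : ℝ) * (2 * ∑ i ∈ S, E.spent j i) ≤
      4 * ∑ j' ∈ E.before j, ((S ∩ supporters A D (E.item j')).card : ℝ) := by
  suffices h : (S.card : ℝ) * (2 * ∑ i ∈ S, E.spent j i +
      ((S.card : ℝ) * ∑ i ∈ S, E.spent j i ^ 2 - (∑ i ∈ S, E.spent j i) ^ 2)) ≤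
      4 * ∑ j' ∈ E.before j, ((S ∩ supporters A D (E.item j')).card : ℝ) by
    refine le_trans (mul_le_mul_of_nonneg_left ?_ (Nat.cast_nonneg _)) h
    have := sq_sum_le_card_mul_sum_sq (s := S) (f := E.spent j)
    linarith
  induction j with
  | zero => simp [spent_zero, before_zero]
  | succ j ih =>
    have ih := ih (by omega) fun j' hj' => hf j' (by omega)
    let a : Fin E.num := ⟨j, hj⟩
    have hstep := potential_step (S := S) (P := S ∩ supporters A D (E.item a))
      inter_subset_left (E.spent j) (E.time a)
      (fun i _ => E.spent_le_time a.2.le a (by simp [a]) i) (hf a (by simp [a]))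
    have hsucc : ∀ i ∈ S, (if i ∈ S ∩ supporters A D (E.item a) then E.time a
        else E.spent j i) = E.spent (j + 1) i := fun i hi => by
      have := E.spent_succ a i
      simp only [a] at this
      simp [this, hi, a]
    have hsq : ∑ i ∈ S, (if i ∈ S ∩ supporters A D (E.item a) then E.time a
        else E.spent j i) ^ 2 = ∑ i ∈ S, E.spent (j + 1) i ^ 2 :=
      sum_congr rfl fun i hi => by rw [hsucc i hi]
    rw [sum_congr rfl hsucc, hsq] at hstep
    have hsum : ∑ i ∈ S, E.spent (j + 1) i = ∑ i ∈ S, E.spent j i +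
        ∑ i ∈ S ∩ supporters A D (E.item a), (E.time a - E.spent j i) := by
      rw [← filter_mem_eq_inter, sum_filter, ← sum_add_distrib]
      refine sum_congr rfl fun i hi => ?_
      rw [← hsucc i hi]
      by_cases h : i ∈ supporters A D (E.item a) <;> simp [h, hi]
    have hbef : E.before (j + 1) = insert a (E.before j) := E.before_succ a
    have hnot : a ∉ E.before j := E.notMem_before a
    rw [hbef, sum_insert hnot]
    rw [hsum] at hstep ⊢
    linarith

theorem card_filter_supporters_le_util (j : ℕ) (i : V) :
    ((E.bought j).filter (fun x => i ∈ supporters A D x)).card ≤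
      util A D i (univ.image E.item) := by
  refine card_le_card fun x hx => ?_
  rw [mem_filter, mem_supporters_iff] at hx
  exact mem_inter.2 ⟨hx.2, image_subset_image (subset_univ _) hx.1⟩

theorem card_payments_le_util (S : Finset V) (j : ℕ) :
    ∑ j' ∈ E.before j, ((S ∩ supporters A D (E.item j')).card : ℝ) ≤
      ∑ i ∈ S, (util A D i (univ.image E.item) : ℝ) := by
  norm_cast
  calc ∑ j' ∈ E.before j, (S ∩ supporters A D (E.item j')).card
      = ∑ i ∈ S, ((E.before j).filter (fun j' => i ∈ supporters A D (E.item j'))).card := by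
        simp only [← filter_mem_eq_inter]
        exact sum_card_bipartiteAbove_eq_sum_card_bipartiteBelow
          (fun j' i => i ∈ supporters A D (E.item j'))
    _ ≤ _ := sum_le_sum fun i _ => by
        refine le_trans (le_of_eq ?_) (E.card_filter_supporters_le_util j i)
        rw [bought, filter_image, card_image_of_injective _ E.item_injective]

theorem sum_spent {j : ℕ} (hj : j ≤ E.num) : ∑ i, E.spent j i = j := by
  simp only [spent]
  rw [sum_comm]
  simp [E.pay, E.card_before hj]

theorem card_unsupported_le_sum_spent (S : Finset V) (j : ℕ) :
    (((E.bought j).filter (fun x => Disjoint S (supporters A D x))).card : ℝ) ≤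
      ∑ i ∈ Sᶜ, E.spent j i := by
  rw [bought, filter_image, card_image_of_injective _ E.item_injective]
  simp only [spent]
  rw [sum_comm, card_filter, Nat.cast_sum]
  refine sum_le_sum fun j' _ => ?_
  split_ifs with h
  · rw [← sum_filter, filter_mem_eq_inter, inter_eq_right.2, E.pay]
    · simp
    · exact fun i hi => mem_compl.2 fun hS => Finset.disjoint_left.1 h hS hi
  · simp only [Nat.cast_zero]
    exact sum_nonneg fun i _ => by split_ifs; exacts [E.bud_nonneg _ _, le_rfl]

/-- When no item supported by all of `S` is available, cohesiveness bounds from below the number of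
purchases other than those in a set `R` of fewer than `ℓ` items supported within `S`. -/
theorem lt_of_not_available (hdisj : ∀ i, Disjoint (A i) (D i)) {S : Finset V} (hS : S.Nonempty)
    {ℓ : ℕ} (hℓ : 0 < ℓ) (hcoh : Cohesive A D k ℓ S) {j : ℕ} (hj : j ≤ E.num)
    (hno : ∀ x, S ⊆ supporters A D x → ¬ availAt k E.item j x) {R : Finset (C ⊕ C)}
    (hRS : ∀ x ∈ R, ¬ Disjoint S (supporters A D x))
    (hcR : (E.bought j).filter (fun x => S ⊆ supporters A D x) ⊆ R) (hR : R.card < ℓ) :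
    (ℓ : ℝ) * Fintype.card V < S.card * ((E.bought j \ R).card + ℓ) := by
  rcases hcoh (E.bought j \ R) ((E.feasible_bought hj).mono sdiff_subset) with
    ⟨X, hX, hXℓ, hf⟩ | h
  · obtain ⟨x, hxX, h1, h2, h3⟩ := exists_addable (R := R) (fun x hx => hcR (mem_filter.2
      ⟨(mem_inter.1 hx).2, subset_supporters_of_mem_common (hX (mem_inter.1 hx).1)⟩))
      (fun x hx hxR => hRS _ hxR (Finset.disjoint_left.2 fun i hi =>
        not_mem_supporters_swap hdisj (subset_supporters_of_mem_common (hX hx) hi))) hR hXℓ hf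
    exact absurd (E.availAt_of_notMem h1 h2 h3) (hno x (subset_supporters_of_mem_common (hX hxX)))
  · have hn : (0 : ℚ) < Fintype.card V := by
      exact_mod_cast Fintype.card_pos_iff.2 ⟨hS.choose⟩
    have hl : (0 : ℚ) < (E.bought j \ R).card + ℓ := by positivity
    rw [div_lt_div_iff₀ hl hn] at h
    exact_mod_cast h

/-- When no item supported by all of `S` is available any more, but one was before each earlier
purchase, an `ℓ`-cohesive group `S` has spent at least `ℓ - 1`, unless it jointly supports `ℓ`
bought items. -/
theorem le_sum_spent (hdisj : ∀ i, Disjoint (A i) (D i)) {S : Finset V} (hS : S.Nonempty)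
    {ℓ : ℕ} (hℓ : 0 < ℓ) (hcoh : Cohesive A D k ℓ S) {j : ℕ} (hj : j ≤ E.num)
    (hno : ∀ x, S ⊆ supporters A D x → ¬ availAt k E.item j x)
    (hf : ∀ j' : Fin E.num, (j' : ℕ) < j → ∑ i ∈ S, (E.time j' - E.spent j' i) ≤ 1)
    (hcommon : ((E.bought j).filter (fun x => S ⊆ supporters A D x)).card < ℓ) :
    (ℓ : ℝ) - 1 ≤ ∑ i ∈ S, E.spent j i := by
  classical
  have hcsub : (E.bought j).filter (fun x => S ⊆ supporters A D x) ⊆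
      (E.bought j).filter (fun x => ¬ Disjoint S (supporters A D x)) := fun x hx => by
    rw [mem_filter] at hx ⊢
    obtain ⟨i, hi⟩ := hS
    exact ⟨hx.1, fun hd => Finset.disjoint_left.1 hd hi (hx.2 hi)⟩
  have hs : (0 : ℝ) < S.card := by exact_mod_cast hS.card_pos
  have hsn : (S.card : ℝ) + (Sᶜ.card : ℝ) = Fintype.card V := by
    exact_mod_cast card_add_card_compl S
  have hc : (0 : ℝ) ≤ (Sᶜ.card : ℝ) := Nat.cast_nonneg _
  have hlR : (0 : ℝ) < ℓ := by exact_mod_cast hℓ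
  have hjpos : 0 < j := by
    rcases Nat.eq_zero_or_pos j with rfl | h
    · have := E.lt_of_not_available hdisj hS hℓ hcoh hj hno (R := ∅) (by simp)
        (by simp [bought, before_zero]) (by simpa using hℓ)
      simp only [bought, before_zero, image_empty, empty_sdiff, card_empty, Nat.cast_zero] at this
      nlinarith
    · exact h
  obtain ⟨p, rfl⟩ := Nat.exists_eq_succ_of_ne_zero hjpos.ne'
  let a : Fin E.num := ⟨p, hj⟩
  have hspS : (S.card : ℝ) * E.time a - 1 ≤ ∑ i ∈ S, E.spent (p + 1) i := by
    have h1 := hf a (by simp [a])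
    rw [sum_sub_distrib, sum_const, nsmul_eq_mul] at h1
    have h2 : ∑ i ∈ S, E.spent a i ≤ ∑ i ∈ S, E.spent (p + 1) i := sum_le_sum fun i _ => by
      have h3 : E.spent (p + 1) i = _ := E.spent_succ a i
      rw [h3]
      split_ifs
      · exact E.spent_le_time a.2.le a (by omega) i
      · exact le_rfl
    linarith
  have hspc : ∑ i ∈ Sᶜ, E.spent (p + 1) i ≤ (Sᶜ.card : ℝ) * E.time a := by
    rw [← nsmul_eq_mul, ← sum_const]
    exact sum_le_sum fun i _ => E.spent_le_time hj a le_rfl i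
  rcases lt_or_ge ((E.bought (p + 1)).filter
    (fun x => ¬ Disjoint S (supporters A D x))).card ℓ with hlt | hge
  · have h := E.lt_of_not_available hdisj hS hℓ hcoh hj hno
      (fun x hx => (mem_filter.1 hx).2) hcsub hlt
    rw [← filter_not] at h
    simp only [not_not] at h
    have h1 := (E.card_unsupported_le_sum_spent S (p + 1)).trans hspc
    have h2 := mul_le_mul_of_nonneg_left h1 hs.le
    have h3 : 0 < (Sᶜ.card : ℝ) * (S.card * E.time a - ℓ) := by
      rw [← hsn] at h
      linarith
    linarith [pos_of_mul_pos_right h3 hc]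
  · obtain ⟨R, hcR, hRsub, hRcard⟩ := exists_subsuperset_card_eq hcsub
      (Nat.le_sub_one_of_lt hcommon) ((Nat.sub_le ℓ 1).trans hge)
    have h := E.lt_of_not_available hdisj hS hℓ hcoh hj hno
      (fun x hx => (mem_filter.1 (hRsub hx)).2) hcR (by omega)
    have hRW : R ⊆ E.bought (p + 1) := hRsub.trans (filter_subset _ _)
    have hcard : ((E.bought (p + 1) \ R).card : ℝ) + ℓ = ((p + 1 : ℕ) : ℝ) + 1 := by
      have h1 := card_sdiff_add_card_eq_card hRW
      rw [E.card_bought hj] at h1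
      have : (E.bought (p + 1) \ R).card + ℓ = p + 1 + 1 := by omega
      exact_mod_cast this
    rw [hcard] at h
    have htot := E.sum_spent hj
    rw [← sum_add_sum_compl S] at htot
    have h1 := mul_le_mul_of_nonneg_left hspS hc
    have h2 : (S.card : ℝ) * (((p + 1 : ℕ) : ℝ) - ∑ i ∈ S, E.spent (p + 1) i) ≤
        S.card * (Sᶜ.card * E.time a) := mul_le_mul_of_nonneg_left (by linarith) hs.le
    have h3 : 0 < (Fintype.card V : ℝ) * (∑ i ∈ S, E.spent (p + 1) i - (ℓ - 1)) := by
      rw [← hsn] at h ⊢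
      linarith
    linarith [pos_of_mul_pos_right h3 (Nat.cast_nonneg _)]

end PhragmenExec

/-- for any outcome `W` returned by Phragmén's rule for
thumbs-up/down voting, every nonempty `ℓ`-cohesive group `S` has average
satisfaction at least `(ℓ - 1)/2`. -/
theorem stmt_4 [Fintype C] [DecidableEq C] [Fintype V] [DecidableEq V]
    (k : ℕ) (A D : V → Finset C)
    (hdisj : ∀ i, Disjoint (A i) (D i)) (hk : 0 < k) (hkm : k ≤ Fintype.card C)
    (E : PhragmenExec A D k) (S : Finset V) (hS : S.Nonempty)
    (ℓ : ℕ) (hℓ : 0 < ℓ) (hcoh : Cohesive A D k ℓ S) :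
    ((ℓ : ℝ) - 1) / 2 ≤
      (∑ i ∈ S, (util A D i (univ.image E.item) : ℝ)) / (S.card : ℝ) := by
  classical
  have hs : (0 : ℝ) < S.card := by exact_mod_cast hS.card_pos
  rw [le_div_iff₀ hs]
  have hend : ∀ x, S ⊆ supporters A D x → ¬ availAt k E.item E.num x := fun x hx hav => by
    obtain ⟨i, hi⟩ := hS
    simpa [E.exhaust x hav] using hx hi
  have hex : ∃ j, ∀ x, S ⊆ supporters A D x → ¬ availAt k E.item j x := ⟨E.num, hend⟩
  let j := Nat.find hex
  have hj : j ≤ E.num := Nat.find_min' hex hend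
  have hno : ∀ x, S ⊆ supporters A D x → ¬ availAt k E.item j x := Nat.find_spec hex
  have hf : ∀ j' : Fin E.num, (j' : ℕ) < j → ∑ i ∈ S, (E.time j' - E.spent j' i) ≤ 1 := by
    intro j' hj'
    have h := Nat.find_min hex hj'
    push Not at h
    obtain ⟨x, hx, hav⟩ := h
    exact E.sum_bud_le_one j' hx hav
  rcases lt_or_ge ((E.bought j).filter (fun x => S ⊆ supporters A D x)).card ℓ with hlt | hge
  · have h1 := E.le_sum_spent hdisj hS hℓ hcoh hj hno hf hlt
    have h2 := E.spent_le_card_payments hj hf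
    have h3 := E.card_payments_le_util S j
    have h4 := mul_le_mul_of_nonneg_left h1 hs.le
    linarith
  · have h1 : ∑ _i ∈ S, (ℓ : ℝ) ≤ ∑ i ∈ S, (util A D i (univ.image E.item) : ℝ) :=
      sum_le_sum fun i hi => by
        refine Nat.cast_le.2 (hge.trans (le_trans (card_le_card fun x hx => ?_)
          (E.card_filter_supporters_le_util j i)))
        rw [mem_filter] at hx ⊢
        exact ⟨hx.1, hx.2 hi⟩
    rw [sum_const, nsmul_eq_mul] at h1
    have h2 : (0 : ℝ) ≤ ℓ := Nat.cast_nonneg _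
    nlinarith
end

section
/- Every priceable outcome with opposition-taxed prices provides weak Group Veto. Precisely: let E=(C,V,k,B) be an election containing a group of voters S' ⊆ V with ⋂_{i∈S'} A_i = {c*} and D_{c*} = ∅. Let W ⊆ C be a committee with c* ∉ W, let p : W → ℝ be a price function with |A_c| > |D_c| and p(c) ≥ |A_c|/(|A_c| − |D_c|) for every c ∈ W, and suppose there are payment functions π_i : W → ℝ≥0 (i ∈ V) with π_i(c) = 0 whenever c ∉ A_i, ∑_{i∈V} π_i(c) ≥ p(c) for every c ∈ W, and ∑_{c∈W} π_i(c) ≤ q for every i ∈ V, where q ∈ ℝ≥0 satisfies |S'|·q < 1 (as holds for an exhaustive priceable rule when c* is not elected). Then for every positive integer ℓ ≤ k, every T ⊆ C with |T| ≥ ℓ, and every S ⊆ V with T ⊆ ⋂_{i∈S} D_i and |S| ≥ |ap(T)| − ℓ·|S'|, it holds |W ∩ T| < ℓ. -/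
open Finset

variable {C V : Type*}

/-- `A_c`: the set of voters approving candidate `c`. -/
def apprs [Fintype V] (A : V → Finset C) (c : C) [DecidableEq C] : Finset V :=
  univ.filter (fun i => c ∈ A i)

/-- `D_c`: the set of voters disapproving candidate `c`. -/
def disapprs [Fintype V] (D : V → Finset C) (c : C) [DecidableEq C] : Finset V :=
  univ.filter (fun i => c ∈ D i)

/-- The opposition-taxed price `p(c) = |A_c| / (|A_c| - |D_c|)`. -/
noncomputable def price [Fintype V] [DecidableEq C] (A D : V → Finset C) (c : C) : ℝ :=
  ((apprs A c).card : ℝ) / (((apprs A c).card : ℝ) - ((disapprs D c).card : ℝ))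

/-- `S` is `ℓ`-positively-cohesive: some `T ⊆ A_S` with `|T| ≥ ℓ` such that
`|S| - |D_c| ≥ ℓ·n/k` for every `c ∈ T`. -/
def PosCohesive [Fintype C] [DecidableEq C] [Fintype V] (A D : V → Finset C)
    (k ℓ : ℕ) (S : Finset V) : Prop :=
  ∃ T ⊆ comInt A S, ℓ ≤ T.card ∧ ∀ c ∈ T,
    (ℓ : ℝ) * (Fintype.card V : ℝ) / (k : ℝ) ≤ (S.card : ℝ) - ((disapprs D c).card : ℝ)

/-- `ap(T)`: the set of voters approving at least one candidate of `T`. -/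
def ap [Fintype V] [DecidableEq C] (A : V → Finset C) (T : Finset C) : Finset V :=
  univ.filter (fun i => (A i ∩ T).Nonempty)
theorem apprs_subset_ap [Fintype V] [DecidableEq C] (A : V → Finset C) {T : Finset C} {c : C}
    (hc : c ∈ T) : apprs A c ⊆ ap A T := by
  intro i hi
  simp only [apprs, ap, mem_filter, mem_univ, true_and] at hi ⊢
  exact ⟨c, mem_inter.2 ⟨hi, hc⟩⟩

theorem subset_disapprs [Fintype V] [DecidableEq C] {D : V → Finset C} {S : Finset V}
    {T : Finset C} (hTD : ∀ i ∈ S, T ⊆ D i) {c : C} (hc : c ∈ T) : S ⊆ disapprs D c := by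
  intro i hi
  simpa only [disapprs, mem_filter, mem_univ, true_and] using hTD i hi hc

/-- Voters approving nothing in `T` pay nothing for candidates in `W ∩ T`. -/
theorem sum_payments_le [Fintype V] [DecidableEq C] {A : V → Finset C} {W : Finset C}
    {π : V → C → ℝ} {q : ℝ} (hπ0 : ∀ i c, 0 ≤ π i c)
    (hπA : ∀ (i : V) (c : C), c ∉ A i → π i c = 0)
    (hbudget : ∀ i : V, ∑ c ∈ W, π i c ≤ q) (T : Finset C) :
    ∑ c ∈ W ∩ T, ∑ i : V, π i c ≤ ((ap A T).card : ℝ) * q := by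
  rw [sum_comm, ← nsmul_eq_mul, ← sum_const]
  have hzero : ∀ i ∈ univ, i ∉ ap A T → ∑ c ∈ W ∩ T, π i c = 0 := by
    intro i _ hi
    refine sum_eq_zero fun c hc => hπA i c fun hcA => hi ?_
    simp only [ap, mem_filter, mem_univ, true_and]
    exact ⟨c, mem_inter.2 ⟨hcA, (mem_inter.1 hc).2⟩⟩
  rw [← sum_subset (subset_univ (ap A T)) hzero]
  exact sum_le_sum fun i _ =>
    (sum_le_sum_of_subset_of_nonneg inter_subset_left fun c _ _ => hπ0 i c).trans (hbudget i)

/-- The ratio `a / (a - d)` is antitone in `a` and monotone in `d`. -/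
theorem le_sub_mul_div_sub {a d n s : ℝ} (hs : 0 ≤ s) (hsd : s ≤ d) (hda : d < a)
    (han : a ≤ n) : n ≤ (n - s) * (a / (a - d)) := by
  rw [← mul_div_assoc, le_div_iff₀ (sub_pos.2 hda)]
  have h : a * s ≤ n * d := mul_le_mul han hsd hs (by linarith)
  linarith

/-- every priceable outcome with opposition-taxed prices provides
weak Group Veto: given a group `S'` with `⋂_{i∈S'} A_i = {c*}` and `D_{c*} = ∅`,
a committee `W` with `c* ∉ W` supported by payments `π_i` covering prices
`p(c) ≥ |A_c|/(|A_c|-|D_c|)` where each voter spends at most `q` with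
`|S'|·q < 1`, it holds `|W ∩ T| < ℓ` for every weakly `(ℓ,T)`-negatively-cohesive
group `S`. -/
theorem stmt_12 [Fintype C] [DecidableEq C] [Fintype V] [DecidableEq V]
    (k : ℕ) (A D : V → Finset C)
    (hdisj : ∀ i, Disjoint (A i) (D i)) (hk : 0 < k) (hkm : k ≤ Fintype.card C)
    (S' : Finset V) (cstar : C)
    (hS' : comInt A S' = {cstar}) (hDstar : disapprs D cstar = ∅)
    (W : Finset C) (hcW : cstar ∉ W) (p : C → ℝ) (π : V → C → ℝ)
    (hpW : ∀ c ∈ W, (disapprs D c).card < (apprs A c).card ∧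
      ((apprs A c).card : ℝ) / (((apprs A c).card : ℝ) - ((disapprs D c).card : ℝ)) ≤ p c)
    (hπ0 : ∀ i c, 0 ≤ π i c)
    (hπA : ∀ (i : V) (c : C), c ∉ A i → π i c = 0)
    (hcover : ∀ c ∈ W, p c ≤ ∑ i : V, π i c)
    (q : ℝ) (hq0 : 0 ≤ q) (hq : (S'.card : ℝ) * q < 1)
    (hbudget : ∀ i : V, ∑ c ∈ W, π i c ≤ q)
    (ℓ : ℕ) (hℓ : 0 < ℓ) (hℓk : ℓ ≤ k)
    (T : Finset C) (hT : ℓ ≤ T.card) (S : Finset V)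
    (hTD : ∀ i ∈ S, T ⊆ D i)
    (hsize : ((ap A T).card : ℝ) - (ℓ : ℝ) * (S'.card : ℝ) ≤ (S.card : ℝ)) :
    (W ∩ T).card < ℓ := by
  rcases (W ∩ T).eq_empty_or_nonempty with hU | ⟨c₀, hc₀⟩
  · simpa [hU] using hℓ
  have bounds : ∀ c ∈ W ∩ T, (S.card : ℝ) ≤ (disapprs D c).card ∧
      ((disapprs D c).card : ℝ) < (apprs A c).card ∧
      ((apprs A c).card : ℝ) ≤ (ap A T).card := by
    intro c hc
    obtain ⟨hcW, hcT⟩ := mem_inter.1 hc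
    exact ⟨mod_cast card_le_card (subset_disapprs hTD hcT), mod_cast (hpW c hcW).1,
      mod_cast card_le_card (apprs_subset_ap A hcT)⟩
  obtain ⟨h₁, h₂, h₃⟩ := bounds c₀ hc₀
  have hS0 : (0 : ℝ) ≤ S.card := Nat.cast_nonneg _
  have hN : (0 : ℝ) < (ap A T).card := by linarith
  have hNS : (0 : ℝ) ≤ (ap A T).card - S.card := by linarith
  have hcost : ((W ∩ T).card : ℝ) * (ap A T).card ≤
      ((ap A T).card - S.card) * ∑ c ∈ W ∩ T, ∑ i : V, π i c := by
    rw [← nsmul_eq_mul, ← sum_const, mul_sum]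
    refine sum_le_sum fun c hc => ?_
    obtain ⟨hSd, hda, haN⟩ := bounds c hc
    have hcW := (mem_inter.1 hc).1
    exact (le_sub_mul_div_sub hS0 hSd hda haN).trans
      (mul_le_mul_of_nonneg_left ((hpW c hcW).2.trans (hcover c hcW)) hNS)
  have htotal := mul_le_mul_of_nonneg_left (sum_payments_le hπ0 hπA hbudget T) hNS
  have hUq : ((W ∩ T).card : ℝ) ≤ ((ap A T).card - S.card) * q :=
    le_of_mul_le_mul_right (by linarith) hN
  have hq' : ((ap A T).card - S.card : ℝ) * q ≤ ℓ * S'.card * q :=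
    mul_le_mul_of_nonneg_right (by linarith) hq0
  have hℓq : (ℓ : ℝ) * (S'.card * q) < ℓ * 1 :=
    mul_lt_mul_of_pos_left hq (mod_cast hℓ)
  have : ((W ∩ T).card : ℝ) < ℓ := by linarith
  exact_mod_cast this
end
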